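/- Let X be a stationary Markov chain on a finite alphabet A = {α₁,…,α_N} with transition matrix P = (p_{ij}) satisfying 0 < p_{ij} < 1 for all 1 ≤ i,j ≤ N, started from its stationary distribution μ, and let f be the run-length encoder. Then the process f(X) is a Markov chain on the countable alphabet B = {(α_i, k) : 1 ≤ i ≤ N, k ∈ ℕ} with transition probabilities q_{(α_i,k)(α_i,ℓ)} = 0 for all i, k, ℓ, and q_{(α_i,k)(α_j,ℓ)} = p_{ij}·p_{jj}^{ℓ−1}·(1−p_{jj})/(1−p_{ii}) for i ≠ j, and with initial distribution π((α_i,k)) = μ(α_i)·p_{ii}^{k−1}·(1−p_{ii}). -/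

import Mathlib

open MeasureTheory Filter Topology

section RLEDefs

variable {A : Type*}

/-- The starting position of the run following the run that starts at position `i`:
the least index `> i` where the value of `x` changes (with the junk convention `i + 1`
if the sequence is constant from position `i` on). -/
noncomputable def nextChange (x : ℕ → A) (i : ℕ) : ℕ := by
  classical
  exact if h : ∃ j, x (i + j + 1) ≠ x i then i + Nat.find h + 1 else i + 1

/-- Starting position of the `n`-th maximal run of the sequence `x`. -/
noncomputable def runStart (x : ℕ → A) : ℕ → ℕ
  | 0 => 0
  | n + 1 => nextChange x (runStart x n)

/-- The run-length encoder `f : A^ℕ → (A × ℕ)^ℕ`: the `n`-th symbol of `f x` is the pair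
(value of the `n`-th maximal run of `x`, length of that run). -/
noncomputable def rle (x : ℕ → A) (n : ℕ) : A × ℕ :=
  (x (runStart x n), runStart x (n + 1) - runStart x n)

/-- `M_n(u,v)`: the length of the longest common substring of `u` and `v`
occurring within their first `n` symbols, i.e.
`max {k : u_i^{i+k-1} = v_j^{j+k-1} for some 0 ≤ i,j ≤ n-k}`. -/
noncomputable def matchLen {C : Type*} (u v : ℕ → C) (n : ℕ) : ℕ :=
  sSup {k | ∃ i j, i + k ≤ n ∧ j + k ≤ n ∧ ∀ m < k, u (i + m) = v (j + m)}

/-- `M^RLE_n(x,y) = M_n(f x, f y)`. -/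
noncomputable def MRLE (x y : ℕ → A) (n : ℕ) : ℕ := matchLen (rle x) (rle y) n

/-- `M̃_n(x,y) = max {k : f(σ^i x)_1^k = f(σ^j y)_1^k for some 0 ≤ i,j ≤ n-k}`. -/
noncomputable def Mtilde (x y : ℕ → A) (n : ℕ) : ℕ :=
  sSup {k | ∃ i j, i + k ≤ n ∧ j + k ≤ n ∧
    ∀ m < k, rle (fun t => x (t + i)) m = rle (fun t => y (t + j)) m}

/-- The number of maximal runs in the first `n` symbols of `x`, i.e. `|f(x_1^n)|`. -/
noncomputable def runCount (x : ℕ → A) (n : ℕ) : ℕ := by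
  classical
  exact ((Finset.range n).filter fun i => i = 0 ∨ x i ≠ x (i - 1)).card

/-- The left shift `σ` on sequences. -/
def shift (x : ℕ → A) : ℕ → A := fun n => x (n + 1)

variable [MeasurableSpace A]

/-- `Σ_{ω ∈ B^n} (f_*μ)(ω)²`: the sum, over all cylinders `ω` of length `n` in
`B^ℕ = (A × ℕ)^ℕ`, of the squared measure of `f⁻¹ω` (where `f` is the run-length
encoder), i.e. of the squared pushforward measure of the cylinder. -/
noncomputable def pushCylSum (μ : Measure (ℕ → A)) (n : ℕ) : ℝ :=
  ∑' ω : Fin n → A × ℕ, ((μ {x | ∀ i : Fin n, rle x i = ω i}).toReal) ^ 2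

/-- Lower Rényi entropy of order 2 of the pushforward measure `f_*μ`:
`H̲₂(f_*μ) = - liminf_n (1/n) log Σ_ω (f_*μ)(ω)²`. -/
noncomputable def H2lower (μ : Measure (ℕ → A)) : ℝ :=
  -liminf (fun n : ℕ => Real.log (pushCylSum μ n) / n) atTop

/-- Upper Rényi entropy of order 2 of the pushforward measure `f_*μ`:
`H̄₂(f_*μ) = - limsup_n (1/n) log Σ_ω (f_*μ)(ω)²`. -/
noncomputable def H2upper (μ : Measure (ℕ → A)) : ℝ :=
  -limsup (fun n : ℕ => Real.log (pushCylSum μ n) / n) atTop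

/-- Hypothesis (A): there are `c > 0`, `h > 0` with `μ(a…a) ≤ c e^{-hn}` for every
constant cylinder `a…a` of length `n`. -/
def HypA (μ : Measure (ℕ → A)) (c h : ℝ) : Prop :=
  0 < c ∧ 0 < h ∧
    ∀ (n : ℕ) (a : A), μ {x | ∀ i < n, x i = a} ≤ ENNReal.ofReal (c * Real.exp (-h * n))

/-- The σ-algebra `F_0^n` generated by the coordinates `X_0, …, X_n`. -/
def cylAlgLE (A : Type*) [MeasurableSpace A] (n : ℕ) : MeasurableSpace (ℕ → A) :=
  MeasurableSpace.comap (fun x (i : Fin (n + 1)) => x i) inferInstance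

/-- The σ-algebra `F_m^∞` generated by the coordinates `X_m, X_{m+1}, …`. -/
def cylAlgGE (A : Type*) [MeasurableSpace A] (m : ℕ) : MeasurableSpace (ℕ → A) :=
  MeasurableSpace.comap (fun x (i : ℕ) => x (m + i)) inferInstance

/-- α-mixing with rate function `a`: for all `n, g` and all `S ∈ F_0^n`, `T ∈ F_{n+g}^∞`,
`|μ(S ∩ T) - μ(S)μ(T)| ≤ a(g)`. -/
def AlphaMixingBound (μ : Measure (ℕ → A)) (a : ℕ → ℝ) : Prop :=
  ∀ (n g : ℕ) (S T : Set (ℕ → A)),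
    MeasurableSet[cylAlgLE A n] S → MeasurableSet[cylAlgGE A (n + g)] T →
    |(μ (S ∩ T)).toReal - (μ S).toReal * (μ T).toReal| ≤ a g

/-- α-mixing with exponential decay. -/
def AlphaMixingExp (μ : Measure (ℕ → A)) : Prop :=
  ∃ C θ : ℝ, 0 < C ∧ 0 < θ ∧ AlphaMixingBound μ fun g => C * Real.exp (-θ * g)

/-- ψ-mixing with polynomial rate `ψ(g) = g^{-a}`: for all `n` and `g ≥ 1` and all
`S ∈ F_0^n`, `T ∈ F_{n+g}^∞`, `|μ(S ∩ T) - μ(S)μ(T)| ≤ g^{-a} μ(S) μ(T)`. -/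
def PsiMixingPoly (μ : Measure (ℕ → A)) (a : ℝ) : Prop :=
  ∀ (n g : ℕ), 1 ≤ g → ∀ (S T : Set (ℕ → A)),
    MeasurableSet[cylAlgLE A n] S → MeasurableSet[cylAlgGE A (n + g)] T →
    |(μ (S ∩ T)).toReal - (μ S).toReal * (μ T).toReal| ≤
      (g : ℝ) ^ (-a) * (μ S).toReal * (μ T).toReal

/-- `S_n = Σ_{0 ≤ i,j ≤ n-1} 1_{A_{i,j}}` with `A_{i,j} = {f(σ^i X)_1^k = f(σ^j Y)_1^k}`,
seen as a random variable on the product space (X = first coordinate, Y = second). -/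
noncomputable def Sn (k n : ℕ) (p : (ℕ → A) × (ℕ → A)) : ℝ := by
  classical
  exact ∑ i ∈ Finset.range n, ∑ j ∈ Finset.range n,
    if ∀ m < k, rle (fun t => p.1 (t + i)) m = rle (fun t => p.2 (t + j)) m then (1 : ℝ) else 0

end RLEDefs

section Aux

variable {A : Type*}

def GoodSeq (x : ℕ → A) : Prop := ∀ i, ∃ j, x (i + j + 1) ≠ x i

def spl (w : ℕ → A) (m : ℕ) (j : A) : ℕ → A := fun i => if i ≤ m then w i else j

theorem nextChange_iff (x : ℕ → A) (hx : GoodSeq x) (r l : ℕ) :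
    nextChange x r = r + l + 1 ↔ (∀ i ≤ l, x (r + i) = x r) ∧ x (r + l + 1) ≠ x r := by
  classical
  have h := hx r
  have e : nextChange x r = r + Nat.find h + 1 := by
    unfold nextChange
    rw [dif_pos h]
  rw [e]
  have e2 : r + Nat.find h + 1 = r + l + 1 ↔ Nat.find h = l := by omega
  rw [e2, Nat.find_eq_iff]
  constructor
  · rintro ⟨h1, h2⟩
    refine ⟨?_, h1⟩
    intro i hi
    rcases i with _ | i
    · rfl
    · have := h2 i (by omega)
      simpa [not_not, add_assoc] using this
  · rintro ⟨h1, h2⟩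
    refine ⟨h2, ?_⟩
    intro n hn
    have := h1 (n + 1) (by omega)
    simpa [not_not, add_assoc] using this

theorem nextChange_gt (x : ℕ → A) (r : ℕ) : r < nextChange x r := by
  classical
  unfold nextChange
  split_ifs <;> omega

theorem rle_iff (x : ℕ → A) (hx : GoodSeq x) (n l : ℕ) (a : A) :
    rle x n = (a, l + 1) ↔ (∀ i ≤ l, x (runStart x n + i) = a) ∧ x (runStart x n + l + 1) ≠ a := by
  have hgt := nextChange_gt x (runStart x n)
  have hi := nextChange_iff x hx (runStart x n) l
  unfold rle
  rw [Prod.mk.injEq]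
  simp only [runStart]
  have e2 : nextChange x (runStart x n) - runStart x n = l + 1 ↔
    nextChange x (runStart x n) = runStart x n + l + 1 := by omega
  rw [e2, hi]
  constructor
  · rintro ⟨rfl, h⟩
    exact h
  · rintro ⟨h1, h2⟩
    have h0 := h1 0 (by omega)
    simp only [add_zero] at h0
    subst h0
    exact ⟨rfl, h1, h2⟩

theorem rle_len (x : ℕ → A) (n l : ℕ) (a : A) (h : rle x n = (a, l)) :
    runStart x (n + 1) = runStart x n + l ∧ 1 ≤ l := by
  have hgt := nextChange_gt x (runStart x n)
  unfold rle at h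
  rw [Prod.mk.injEq] at h
  have h2 := h.2
  simp only [runStart] at h2 ⊢
  omega

def RunRep (ω : ℕ → A × ℕ) (n m : ℕ) (w : ℕ → A) : Prop :=
  w m = (ω n).1 ∧ ∀ x, GoodSeq x →
    (((∀ t ≤ n, rle x t = ω t) ↔ ((∀ i ≤ m, x i = w i) ∧ x (m + 1) ≠ w m)) ∧
      ((∀ t ≤ n, rle x t = ω t) → runStart x (n + 1) = m + 1))

theorem rep_zero (ω : ℕ → A × ℕ) (a : A) (l : ℕ) (h : ω 0 = (a, l + 1)) :
    RunRep ω 0 l (fun _ => a) := by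
  refine ⟨by simp [h], fun x hx => ⟨?_, ?_⟩⟩
  · have := rle_iff x hx 0 l a
    simpa [h, runStart] using this
  · intro h'
    have := rle_len x 0 (l + 1) a (by rw [h' 0 le_rfl, h])
    simpa [runStart] using this.1

theorem rep_succ (ω : ℕ → A × ℕ) (n m : ℕ) (w : ℕ → A) (hr : RunRep ω n m w) (a : A) (l : ℕ)
    (h : ω (n + 1) = (a, l + 1)) (ha : (ω n).1 ≠ a) :
    RunRep ω (n + 1) (m + 1 + l) (spl w m a) := by
  obtain ⟨hw, hr⟩ := hr
  have e : ∀ x : ℕ → A, (∀ t ≤ n + 1, rle x t = ω t) ↔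
      ((∀ t ≤ n, rle x t = ω t) ∧ rle x (n + 1) = ω (n + 1)) := by
    intro x
    constructor
    · intro h
      exact ⟨fun t ht => h t (by omega), h _ le_rfl⟩
    · rintro ⟨h1, h2⟩ t ht
      rcases Nat.lt_or_ge n t with h' | h'
      · obtain rfl : t = n + 1 := by omega
        exact h2
      · exact h1 t h'
  have hl : spl w m a (m + 1 + l) = a := by
    unfold spl
    rw [if_neg (by omega)]
  refine ⟨by rw [hl, h], fun x hx => ⟨?_, ?_⟩⟩
  · rw [e, hl]
    obtain ⟨h1, h2⟩ := hr x hx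
    constructor
    · rintro ⟨h3, h4⟩
      have h5 := h2 h3
      rw [h, rle_iff x hx, h5] at h4
      have h6 := h1.1 h3
      refine ⟨?_, by have := h4.2; rwa [show m + 1 + l + 1 = m + 1 + l + 1 from rfl]⟩
      intro i hi
      unfold spl
      split_ifs with hc
      · exact h6.1 i hc
      · have := h4.1 (i - (m + 1)) (by omega)
        rwa [show m + 1 + (i - (m + 1)) = i by omega] at this
    · rintro ⟨h3, h4⟩
      have h6 : (∀ i ≤ m, x i = w i) ∧ x (m + 1) ≠ w m := by
        constructor
        · intro i hi
          have := h3 i (by omega)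
          rw [this]
          unfold spl
          rw [if_pos hi]
        · rw [h3 (m + 1) (by omega)]
          unfold spl
          rw [if_neg (by omega), hw]
          exact ha.symm
      have h7 := h1.2 h6
      refine ⟨h7, ?_⟩
      rw [h, rle_iff x hx, h2 h7]
      refine ⟨?_, h4⟩
      intro i hi
      rw [h3 _ (by omega)]
      unfold spl
      rw [if_neg (by omega)]
  · intro h'
    rw [e] at h'
    have h5 := (hr x hx).2 h'.1
    have := rle_len x (n + 1) (l + 1) a (by rw [h'.2, h])
    omega

theorem rle_ne (x : ℕ → A) (hx : GoodSeq x) (n : ℕ) : (rle x n).1 ≠ (rle x (n + 1)).1 := by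
  obtain ⟨l, hl⟩ : ∃ l, (rle x n).2 = l + 1 := by
    have := (rle_len x n (rle x n).2 (rle x n).1 rfl).2
    exact ⟨(rle x n).2 - 1, by omega⟩
  have h : rle x n = ((rle x n).1, l + 1) := by rw [← hl]
  have h1 := (rle_iff x hx n l _).1 h
  have h2 := (rle_len x n _ _ h).1
  have h3 : (rle x (n + 1)).1 = x (runStart x (n + 1)) := rfl
  rw [h3, h2]
  exact h1.2.symm

theorem rep_exists (ω : ℕ → A × ℕ) (n : ℕ) :
    (∀ x, GoodSeq x → ¬ ∀ t ≤ n, rle x t = ω t) ∨ ∃ m w, RunRep ω n m w := by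
  by_cases hex : ∃ x, GoodSeq x ∧ ∀ t ≤ n, rle x t = ω t
  · right
    obtain ⟨x, hx, hxn⟩ := hex
    have hlen : ∀ t ≤ n, ∃ l, ω t = ((ω t).1, l + 1) := by
      intro t ht
      have := (rle_len x t (ω t).2 (ω t).1 (hxn t ht)).2
      exact ⟨(ω t).2 - 1, by rw [Nat.sub_add_cancel this]⟩
    have : ∀ k ≤ n, ∃ m w, RunRep ω k m w := by
      intro k
      induction k with
      | zero =>
        intro hk
        obtain ⟨l, hl⟩ := hlen 0 hk
        exact ⟨_, _, rep_zero ω _ l hl⟩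
      | succ k ih =>
        intro hk
        obtain ⟨m, w, hr⟩ := ih (by omega)
        obtain ⟨l, hl⟩ := hlen (k + 1) hk
        refine ⟨_, _, rep_succ ω k m w hr _ l hl ?_⟩
        have := rle_ne x hx k
        rwa [hxn k (by omega), hxn (k + 1) hk] at this
    exact this n le_rfl
  · left
    intro x hx h
    exact hex ⟨x, hx, h⟩

end Aux

section Aux2

variable {N : ℕ}

def cw (P : Fin N → Fin N → ℝ) (pi0 : Fin N → ℝ) (m : ℕ) (w : ℕ → Fin N) : ℝ :=
  pi0 (w 0) * ∏ i ∈ Finset.range m, P (w i) (w (i + 1))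

theorem cw_congr (P : Fin N → Fin N → ℝ) (pi0 : Fin N → ℝ) (m : ℕ) (w w' : ℕ → Fin N)
    (h : ∀ i ≤ m, w i = w' i) : cw P pi0 m w = cw P pi0 m w' := by
  unfold cw
  rw [h 0 (by omega)]
  congr 1
  apply Finset.prod_congr rfl
  intro i hi
  rw [Finset.mem_range] at hi
  rw [h i (by omega), h (i + 1) (by omega)]

theorem cw_succ (P : Fin N → Fin N → ℝ) (pi0 : Fin N → ℝ) (m : ℕ) (w : ℕ → Fin N) :
    cw P pi0 (m + 1) w = cw P pi0 m w * P (w m) (w (m + 1)) := by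
  unfold cw
  rw [Finset.prod_range_succ, mul_assoc]

theorem cw_spl (P : Fin N → Fin N → ℝ) (pi0 : Fin N → ℝ) (m l : ℕ) (w : ℕ → Fin N) (a : Fin N) :
    cw P pi0 (m + 1 + l) (spl w m a) = cw P pi0 m w * P (w m) a * P a a ^ l := by
  induction l with
  | zero =>
    rw [add_zero, cw_succ, pow_zero, mul_one,
      cw_congr P pi0 m (spl w m a) w (fun i hi => by simp [spl, hi])]
    simp [spl]
  | succ l ih =>
    rw [← add_assoc, cw_succ, ih, pow_succ]
    have h1 : spl w m a (m + 1 + l) = a := by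
      unfold spl; rw [if_neg (by omega)]
    have h2 : spl w m a (m + 1 + l + 1) = a := by
      unfold spl; rw [if_neg (by omega)]
    rw [h1, h2, mul_assoc]

theorem cw_nonneg (P : Fin N → Fin N → ℝ) (hP : ∀ i j, 0 < P i j ∧ P i j < 1)
    (pi0 : Fin N → ℝ) (hpi0 : ∀ i, 0 ≤ pi0 i) (m : ℕ) (w : ℕ → Fin N) : 0 ≤ cw P pi0 m w :=
  mul_nonneg (hpi0 _) (Finset.prod_nonneg fun i _ => (hP _ _).1.le)

def Cyl (m : ℕ) (w : ℕ → Fin N) : Set (ℕ → Fin N) := {x | ∀ i ≤ m, x i = w i}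

theorem cyl_meas (m : ℕ) (w : ℕ → Fin N) : MeasurableSet (Cyl m w) := by
  have : Cyl m w = ⋂ i : ℕ, ⋂ _ : i ≤ m, (fun x : ℕ → Fin N => x i) ⁻¹' {w i} := by
    ext x
    simp [Cyl]
  rw [this]
  exact MeasurableSet.iInter fun i => MeasurableSet.iInter fun _ =>
    measurable_pi_apply i (measurableSet_singleton _)

variable (P : Fin N → Fin N → ℝ) (hP : ∀ i j, 0 < P i j ∧ P i j < 1)
  (pi0 : Fin N → ℝ) (hpi0 : ∀ i, 0 ≤ pi0 i) (μ : Measure (ℕ → Fin N)) [IsProbabilityMeasure μ]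
  (hC : ∀ m w, μ (Cyl m w) = ENNReal.ofReal (cw P pi0 m w))

include hP hpi0 hC

theorem tail_null (m : ℕ) (w : ℕ → Fin N) :
    μ {x | (∀ i ≤ m, x i = w i) ∧ ∀ j, x (m + j + 1) = w m} = 0 := by
  set S := {x : ℕ → Fin N | (∀ i ≤ m, x i = w i) ∧ ∀ j, x (m + j + 1) = w m}
  have hle : ∀ l, μ S ≤ ENNReal.ofReal (cw P pi0 m w * P (w m) (w m) * P (w m) (w m) ^ l) := by
    intro l
    rw [← cw_spl, ← hC]
    apply measure_mono
    rintro x ⟨h1, h2⟩ i hi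
    unfold spl
    split_ifs with hc
    · exact h1 i hc
    · have := h2 (i - m - 1)
      rwa [show m + (i - m - 1) + 1 = i by omega] at this
  have ht : Tendsto (fun l : ℕ => ENNReal.ofReal
      (cw P pi0 m w * P (w m) (w m) * P (w m) (w m) ^ l)) atTop (𝓝 0) := by
    rw [← ENNReal.ofReal_zero]
    apply ENNReal.tendsto_ofReal
    have := (tendsto_pow_atTop_nhds_zero_of_lt_one (hP (w m) (w m)).1.le
      (hP (w m) (w m)).2).const_mul (cw P pi0 m w * P (w m) (w m))
    simpa using this
  exact le_antisymm (ge_of_tendsto' ht hle) zero_le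

theorem good_ae : ∀ᵐ x ∂μ, GoodSeq x := by
  unfold GoodSeq
  rw [ae_all_iff]
  intro m
  rw [ae_iff]
  have : {x : ℕ → Fin N | ¬ ∃ j, x (m + j + 1) ≠ x m} ⊆
      ⋃ v : Fin (m + 1) → Fin N, {x | (∀ i ≤ m, x i = v (Fin.ofNat (m + 1) i)) ∧
        ∀ j, x (m + j + 1) = v (Fin.ofNat (m + 1) m)} := by
    intro x hx
    simp only [Set.mem_ofPred_eq, not_exists, not_not] at hx
    rw [Set.mem_iUnion]
    refine ⟨fun i => x i, ?_, ?_⟩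
    · intro i hi
      simp [Nat.mod_eq_of_lt (Nat.lt_succ_of_le hi)]
    · intro j
      simp [hx j]
  refine measure_mono_null this (measure_iUnion_null fun v => ?_)
  exact tail_null P hP pi0 hpi0 μ hC m (fun i => v (Fin.ofNat (m + 1) i))

theorem exit_measure (m : ℕ) (w : ℕ → Fin N) :
    μ {x | (∀ i ≤ m, x i = w i) ∧ x (m + 1) ≠ w m} =
      ENNReal.ofReal (cw P pi0 m w * (1 - P (w m) (w m))) := by
  have e : {x : ℕ → Fin N | (∀ i ≤ m, x i = w i) ∧ x (m + 1) ≠ w m} =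
      Cyl m w \ Cyl (m + 1 + 0) (spl w m (w m)) := by
    ext x
    simp only [Set.mem_ofPred_eq, Set.mem_diff, Cyl]
    constructor
    · rintro ⟨h1, h2⟩
      refine ⟨h1, fun h => h2 ?_⟩
      have := h (m + 1) (by omega)
      simpa [spl] using this
    · rintro ⟨h1, h2⟩
      refine ⟨h1, fun h => h2 ?_⟩
      intro i hi
      unfold spl
      split_ifs with hc
      · exact h1 i hc
      · obtain rfl : i = m + 1 := by omega
        exact h
  have hsub : Cyl (m + 1 + 0) (spl w m (w m)) ⊆ Cyl m w := by
    intro x hx i hi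
    have := hx i (by omega)
    simpa [spl, hi] using this
  rw [e, measure_diff hsub (cyl_meas _ _).nullMeasurableSet (measure_ne_top _ _), hC, hC, cw_spl,
    ← ENNReal.ofReal_sub]
  · congr 1
    ring
  · have := cw_nonneg P hP pi0 hpi0 m w
    have := (hP (w m) (w m)).1
    positivity

theorem rep_measure (ω : ℕ → Fin N × ℕ) (n m : ℕ) (w : ℕ → Fin N) (hr : RunRep ω n m w) :
    μ {x | ∀ t ≤ n, rle x t = ω t} =
      ENNReal.ofReal (cw P pi0 m w * (1 - P (ω n).1 (ω n).1)) := by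
  rw [← hr.1, ← exit_measure P hP pi0 hpi0 μ hC m w]
  apply measure_congr
  filter_upwards [good_ae P hP pi0 hpi0 μ hC] with x hx
  exact propext (hr.2 x hx).1

theorem null_measure (ω : ℕ → Fin N × ℕ) (n : ℕ)
    (h : ∀ x, GoodSeq x → ¬ ∀ t ≤ n, rle x t = ω t) :
    μ {x | ∀ t ≤ n, rle x t = ω t} = 0 := by
  have : ∀ᵐ x ∂μ, ¬ ∀ t ≤ n, rle x t = ω t := by
    filter_upwards [good_ae P hP pi0 hpi0 μ hC] with x hx
    exact h x hx
  rw [ae_iff] at this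
  simpa only [not_not] using this

theorem step_measure (ω : ℕ → Fin N × ℕ) (n l : ℕ) (j : Fin N) (hω : ω (n + 1) = (j, l + 1)) :
    μ {x | ∀ t ≤ n + 1, rle x t = ω t} =
      ENNReal.ofReal (if (ω n).1 = j then 0
        else P (ω n).1 j * P j j ^ l * (1 - P j j) / (1 - P (ω n).1 (ω n).1)) *
      μ {x | ∀ t ≤ n, rle x t = ω t} := by
  split_ifs with hj
  · rw [ENNReal.ofReal_zero, zero_mul]
    apply null_measure P hP pi0 hpi0 μ hC
    intro x hx h
    apply rle_ne x hx n
    rw [h n (by omega), h (n + 1) le_rfl, hω, hj]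
  · rcases rep_exists ω n with h | ⟨m, w, hr⟩
    · rw [null_measure P hP pi0 hpi0 μ hC ω n h, mul_zero]
      apply null_measure P hP pi0 hpi0 μ hC
      intro x hx h'
      exact h x hx fun t ht => h' t (by omega)
    · rw [rep_measure P hP pi0 hpi0 μ hC ω n m w hr,
        rep_measure P hP pi0 hpi0 μ hC ω (n + 1) _ _ (rep_succ ω n m w hr j l hω hj), cw_spl, hω,
        hr.1]
      have h1 : 0 < 1 - P (ω n).1 (ω n).1 := by linarith [(hP (ω n).1 (ω n).1).2]
      have h2 : 0 < 1 - P j j := by linarith [(hP j j).2]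
      have h3 := (hP (ω n).1 j).1
      have h4 := (hP j j).1
      rw [← ENNReal.ofReal_mul (by positivity)]
      congr 1
      field_simp

end Aux2

/-- Example `exmark2`: if `X` is a stationary Markov chain on
`A = {α₁,…,α_N}` (modelled as `Fin N`) with transition matrix `P`, `0 < p_{ij} < 1`,
started from its stationary distribution `π`, then `f(X)` is a Markov chain on
`B = A × ℕ` with initial distribution `π((α_i,k)) = μ(α_i) p_{ii}^{k-1}(1-p_{ii})`
and transition probabilities `q_{(α_i,k)(α_i,ℓ)} = 0`,
`q_{(α_i,k)(α_j,ℓ)} = p_{ij} p_{jj}^{ℓ-1}(1-p_{jj})/(1-p_{ii})` for `i ≠ j`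
(the Markov property being expressed multiplicatively:
`μ(past ∧ next state (j,ℓ)) = q_{(last state)(j,ℓ)} · μ(past)`). -/
theorem stmt17 (N : ℕ) (hN : 2 ≤ N) (P : Fin N → Fin N → ℝ)
    (hP : ∀ i j, 0 < P i j ∧ P i j < 1) (hrow : ∀ i, ∑ j, P i j = 1)
    (pi0 : Fin N → ℝ) (hpi0 : ∀ i, 0 ≤ pi0 i) (hpisum : ∑ i, pi0 i = 1)
    (hstat : ∀ j, ∑ i, pi0 i * P i j = pi0 j)
    (μ : Measure (ℕ → Fin N)) [IsProbabilityMeasure μ]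
    (hμ : ∀ (n : ℕ) (w : Fin (n + 1) → Fin N),
      μ {x | ∀ i : Fin (n + 1), x i = w i} =
        ENNReal.ofReal (pi0 (w 0) * ∏ i : Fin n, P (w i.castSucc) (w i.succ))) :
    (∀ (i : Fin N) (k : ℕ), 1 ≤ k →
        μ {x | rle x 0 = (i, k)} =
          ENNReal.ofReal (pi0 i * P i i ^ (k - 1) * (1 - P i i))) ∧
    (∀ (n : ℕ) (ω : Fin (n + 1) → Fin N × ℕ) (j : Fin N) (ℓ : ℕ), 1 ≤ ℓ →
        μ {x | (∀ t : Fin (n + 1), rle x t = ω t) ∧ rle x (n + 1) = (j, ℓ)} =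
          ENNReal.ofReal
            (if (ω (Fin.last n)).1 = j then 0
             else P (ω (Fin.last n)).1 j * P j j ^ (ℓ - 1) * (1 - P j j) /
               (1 - P (ω (Fin.last n)).1 (ω (Fin.last n)).1)) *
            μ {x | ∀ t : Fin (n + 1), rle x t = ω t}) := by
  have hC : ∀ m w, μ (Cyl m w) = ENNReal.ofReal (cw P pi0 m w) := by
    intro m w
    have h := hμ m (fun i => w i)
    have e : {x : ℕ → Fin N | ∀ i : Fin (m + 1), x i = w i} = Cyl m w := by
      ext x
      simp only [Set.mem_ofPred_eq, Cyl]
      exact ⟨fun h i hi => h ⟨i, by omega⟩, fun h i => h i (by omega)⟩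
    rw [e] at h
    rw [h]
    unfold cw
    rw [Finset.prod_range]
    rfl
  constructor
  · intro i k hk
    obtain ⟨l, rfl⟩ : ∃ l, k = l + 1 := ⟨k - 1, by omega⟩
    have := rep_measure P hP pi0 hpi0 μ hC (fun _ => (i, l + 1)) 0 l _ (rep_zero _ i l rfl)
    simpa [cw] using this
  · intro n ω j k hk
    obtain ⟨l, rfl⟩ : ∃ l, k = l + 1 := ⟨k - 1, by omega⟩
    have h := step_measure P hP pi0 hpi0 μ hC
      (fun t => if h : t < n + 1 then ω ⟨t, h⟩ else (j, l + 1)) n l j (by simp)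
    have e0 : ∀ x : ℕ → Fin N, (∀ t ≤ n, rle x t =
        (fun t => if h : t < n + 1 then ω ⟨t, h⟩ else (j, l + 1)) t) ↔
        ∀ t : Fin (n + 1), rle x t = ω t := by
      intro x
      constructor
      · intro h t
        have h9 := h t (by omega)
        have h8 : (t : ℕ) < n + 1 := t.2
        simp only [h8, dif_pos] at h9
        exact h9
      · intro h t ht
        have := h ⟨t, by omega⟩
        simpa [Nat.lt_succ_of_le ht] using this
    have e1 : ∀ x : ℕ → Fin N, (∀ t ≤ n + 1, rle x t =
        (fun t => if h : t < n + 1 then ω ⟨t, h⟩ else (j, l + 1)) t) ↔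
        ((∀ t : Fin (n + 1), rle x t = ω t) ∧ rle x (n + 1) = (j, l + 1)) := by
      intro x
      rw [← e0]
      constructor
      · intro h
        exact ⟨fun t ht => h t (by omega), by simpa using h (n + 1) le_rfl⟩
      · rintro ⟨h1, h2⟩ t ht
        rcases Nat.lt_or_ge n t with h' | h'
        · obtain rfl : t = n + 1 := by omega
          simpa using h2
        · exact h1 t h'
    simp only [e0, e1] at h
    have e2 : (if h : n < n + 1 then ω ⟨n, h⟩ else (j, l + 1)) = ω (Fin.last n) := by
      rw [dif_pos (Nat.lt_succ_self n)]
      rfl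
    rw [e2] at h
    simpa only [Nat.add_sub_cancel] using h
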